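/- Let B and R be C4-free simple graphs on the same finite vertex set V, assume that G(B,R) is the complete graph on V, and assume that every proper subset U ⊊ V is obedient. If there exists a weak clique cutset in B (a clique C ⊊ V of B together with disjoint nonempty sets P, Q with V \ C = P ∪ Q such that no vertex of P is joined to a vertex of Q by an edge of B that is not an edge of R), then V is obedient. -/

import Mathlib

/-- A graph is `C4`-free: it has no induced cycle on four vertices. -/
def IsC4Free {V : Type*} (G : SimpleGraph V) : Prop :=
  ¬ ∃ a b c d : V, a ≠ c ∧ b ≠ d ∧
    G.Adj a b ∧ G.Adj b c ∧ G.Adj c d ∧ G.Adj d a ∧ ¬ G.Adj a c ∧ ¬ G.Adj b d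

/-- A set `U` is obedient (w.r.t. `B` and `R`) if it is the union of a
`B`-clique and an `R`-clique. -/
def Obedient {V : Type*} (B R : SimpleGraph V) (U : Set V) : Prop :=
  ∃ X Y : Set V, B.IsClique X ∧ R.IsClique Y ∧ U = X ∪ Y

/-- Let `C` be a `B`-clique, `P` an `R`-clique and `Q` a set completely joined to `P` in `R`,
covering the vertex set. If the complement of some `p ∈ P` is obedient, then so is the whole
vertex set. -/
theorem Obedient.univ_of_compl_singleton {V : Type*} {B R : SimpleGraph V}
    (hB4 : IsC4Free B) (hR4 : IsC4Free R)
    (hBR : ∀ a b, a ≠ b → B.Adj a b ∨ R.Adj a b) {C P Q : Set V} (hC : B.IsClique C)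
    (hP : R.IsClique P) (hPQ : ∀ p ∈ P, ∀ q ∈ Q, R.Adj p q) (hcover : ∀ v, v ∈ C ∨ v ∈ P ∨ v ∈ Q)
    {p : V} (hp : p ∈ P) (hob : Obedient B R {p}ᶜ) : Obedient B R Set.univ := by
  obtain ⟨X, Y, hX, hY, hXY⟩ := hob
  have hmem : ∀ v, v ≠ p ↔ v ∈ X ∨ v ∈ Y := fun v => by
    rw [← Set.mem_union, ← hXY]; simp
  let N : Set V := {h | h ∈ Y ∧ ¬ R.Adj p h}
  let Z : Set V := {z | z ∈ X ∧ ∃ h ∈ N, z ≠ h ∧ ¬ B.Adj z h}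
  have hNC : N ⊆ C := by
    rintro h ⟨hhY, hph⟩
    have hne := (hmem h).2 (Or.inr hhY)
    rcases hcover h with hc | hc | hc
    · exact hc
    · exact (hph (hP hp hc hne.symm)).elim
    · exact (hph (hPQ p hp h hc)).elim
  have hZC : ∀ z ∈ Z, z ∈ P ∨ z ∈ Q := by
    rintro z ⟨-, h, hh, hne, hzh⟩
    rcases hcover z with hc | hc
    · exact (hzh (hC hc (hNC hh) hne)).elim
    · exact hc
  have hpZ : ∀ z ∈ Z, R.Adj p z := fun z hz => (hZC z hz).elim
    (fun h => hP hp h ((hmem z).2 (Or.inl hz.1)).symm) (hPQ p hp z)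
  -- Otherwise `p, z, h, y` would be an induced `C4` of `R`.
  have key : ∀ z ∈ Z, ∀ h ∈ N, R.Adj z h → ∀ y, R.Adj h y → R.Adj y p → z ≠ y → R.Adj z y := by
    intro z hz h hh hzh y hhy hyp hne
    by_contra hzy
    exact hR4 ⟨p, z, h, y, ((hmem h).2 (Or.inr hh.1)).symm, hne, hpZ z hz, hzh, hhy, hyp,
      hh.2, hzy⟩
  have hZY : ∀ z ∈ Z, ∀ y ∈ Y \ N, z ≠ y → R.Adj z y := by
    rintro z hz y ⟨hy, hyN⟩ hne
    obtain ⟨-, h, hh, hzne, hzh⟩ := id hz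
    have hpy : R.Adj p y := by
      by_contra hpy
      exact hyN ⟨hy, hpy⟩
    have hhy : h ≠ y := by
      rintro rfl
      exact hyN hh
    exact key z hz h hh ((hBR z h hzne).resolve_left hzh) y (hY hh.1 hy hhy) hpy.symm hne
  have hZZ : R.IsClique Z := by
    intro z hz z' hz' hne
    by_contra hzz
    obtain ⟨hzX, h, hh, hzne, hzh⟩ := id hz
    obtain ⟨hzX', h', hh', hzne', hzh'⟩ := id hz'
    have hzhR := (hBR z h hzne).resolve_left hzh
    have hzhR' := (hBR z' h' hzne').resolve_left hzh'
    have h1 : ¬ R.Adj h z' := fun hc => hzz (key z hz h hh hzhR z' hc (hpZ z' hz').symm hne)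
    have h2 : ¬ R.Adj h' z := fun hc =>
      hzz (key z' hz' h' hh' hzhR' z hc (hpZ z hz).symm hne.symm).symm
    have hhh : h ≠ h' := by
      rintro rfl
      exact h1 hzhR'.symm
    have hne1 : h ≠ z' := by
      rintro rfl
      exact hzz hzhR
    have hne2 : h' ≠ z := by
      rintro rfl
      exact hzz hzhR'.symm
    exact hB4 ⟨z, z', h, h', hzne, hzne', hX hzX hzX' hne, ((hBR h z' hne1).resolve_right h1).symm,
      hC (hNC hh) (hNC hh') hhh, (hBR h' z hne2).resolve_right h2, hzh, hzh'⟩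
  refine ⟨(X \ Z) ∪ N, insert p ((Y \ N) ∪ Z), ?_, ?_, ?_⟩
  · have hXN : ∀ x ∈ X \ Z, ∀ n ∈ N, x ≠ n → B.Adj x n := by
      rintro x ⟨hx, hxZ⟩ n hn hne
      by_contra hxn
      exact hxZ ⟨hx, n, hn, hne, hxn⟩
    rintro a (ha | ha) b (hb | hb) hne
    · exact hX ha.1 hb.1 hne
    · exact hXN a ha b hb hne
    · exact (hXN b hb a ha hne.symm).symm
    · exact hC (hNC ha) (hNC hb) hne
  · refine SimpleGraph.IsClique.insert ?_ ?_
    · rintro a (ha | ha) b (hb | hb) hne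
      · exact hY ha.1 hb.1 hne
      · exact (hZY b hb a ha hne.symm).symm
      · exact hZY a ha b hb hne
      · exact hZZ ha hb hne
    · rintro b (⟨hb, hbN⟩ | hb) -
      · by_contra hpb
        exact hbN ⟨hb, hpb⟩
      · exact hpZ b hb
  · ext v
    have := hmem v
    simp only [Set.mem_univ, Set.mem_union, Set.mem_sdiff, Set.mem_insert_iff, true_iff]
    tauto

theorem stmt_3 {V : Type*} [Fintype V] (B R : SimpleGraph V)
    (hB4 : IsC4Free B) (hR4 : IsC4Free R)
    (hcomplete : B ⊔ R = ⊤)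
    (hproper : ∀ U : Set V, U ⊂ Set.univ → Obedient B R U)
    (hcutset : ∃ (C P Q : Set V), B.IsClique C ∧ C ≠ Set.univ ∧
      P.Nonempty ∧ Q.Nonempty ∧ Disjoint P Q ∧ Set.univ \ C = P ∪ Q ∧
      ∀ p ∈ P, ∀ q ∈ Q, ¬ (B.Adj p q ∧ ¬ R.Adj p q)) :
    Obedient B R Set.univ := by
  obtain ⟨C, P, Q, hC, -, ⟨p, hp⟩, ⟨q, hq⟩, hdisj, hcov, hno⟩ := hcutset
  have hBR : ∀ a b, a ≠ b → B.Adj a b ∨ R.Adj a b := fun a b hne => by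
    rw [← SimpleGraph.sup_adj, hcomplete]
    exact hne
  have hcover : ∀ v, v ∈ C ∨ v ∈ P ∨ v ∈ Q := fun v => by
    have : v ∈ Set.univ \ C ↔ v ∈ P ∪ Q := by rw [hcov]
    simp only [Set.mem_sdiff, Set.mem_univ, true_and, Set.mem_union] at this
    tauto
  have hPQ : ∀ p ∈ P, ∀ q ∈ Q, R.Adj p q := fun p hp q hq => by
    have := hBR p q (hdisj.ne_of_mem hp hq)
    have := hno p hp q hq
    tauto
  have hob : ∀ v, Obedient B R {v}ᶜ := fun v =>
    hproper _ (Set.ssubset_univ_iff.2 fun h => (h ▸ Set.mem_univ v : v ∈ ({v}ᶜ : Set V)) rfl)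
  by_cases hP : R.IsClique P
  · exact Obedient.univ_of_compl_singleton hB4 hR4 hBR hC hP hPQ hcover hp (hob p)
  · have hQ : R.IsClique Q := by
      intro b hb d hd hbd
      by_contra hbdR
      refine hP fun a ha c hc hac => ?_
      by_contra hacR
      exact hR4 ⟨a, b, c, d, hac, hbd, hPQ a ha b hb, (hPQ c hc b hb).symm, hPQ c hc d hd,
        (hPQ a ha d hd).symm, hacR, hbdR⟩
    exact Obedient.univ_of_compl_singleton hB4 hR4 hBR hC hQ
      (fun q hq p hp => (hPQ p hp q hq).symm) (fun v => (hcover v).imp_right Or.symm) hq (hob q)
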